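/- Let H : (0,∞) × ℝ → (0,∞) be differentiable and suppose there exist r₁, C₁, C₂ > 0 such that C₁ ≤ H(r,φ) ≤ C₂ for all r ∈ (0, r₁], and the partial derivatives ∂H/∂r and ∂H/∂φ are bounded on (0, r₁] × ℝ. Define T(r,φ) = (r·H(r,φ), φ) and S = Θ ∘ T ∘ Θ^{−1} where Θ(r,φ) = (r cosφ, r sinφ). Then S is a bi-Lipschitz map on the intersection of some punctured neighborhood of the origin with the half-plane {x > 0} ⊂ ℝ². -/

import Mathlib

open Real

/-- Polar coordinates map. -/
noncomputable def Theta (p : ℝ × ℝ) : ℝ × ℝ := (p.1 * Real.cos p.2, p.1 * Real.sin p.2)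

/-- Inverse of the polar coordinates map on the half-plane `{x > 0}`. -/
noncomputable def ThetaInv (p : ℝ × ℝ) : ℝ × ℝ :=
  (Real.sqrt (p.1 ^ 2 + p.2 ^ 2), Real.arctan (p.2 / p.1))

lemma polar_est (a b α β : ℝ) (ha : 0 < a) (hb : 0 < b) (h : |α - β| ≤ π) :
    |a - b| ≤ 2 * ‖Theta (a, α) - Theta (b, β)‖ ∧
    b * |α - β| ≤ 8 * ‖Theta (a, α) - Theta (b, β)‖ ∧
    ‖Theta (a, α) - Theta (b, β)‖ ≤ |a - b| + b * |α - β| := by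
  set N := ‖Theta (a, α) - Theta (b, β)‖ with hN
  have hN0 : 0 ≤ N := norm_nonneg _
  have hx : |a * cos α - b * cos β| ≤ N := by
    have := norm_fst_le (Theta (a, α) - Theta (b, β))
    exact this
  have hy : |a * sin α - b * sin β| ≤ N := by
    have := norm_snd_le (Theta (a, α) - Theta (b, β))
    exact this
  have hx2 : (a * cos α - b * cos β) ^ 2 ≤ N ^ 2 := sq_le_sq' (abs_le.1 hx).1 (abs_le.1 hx).2
  have hy2 : (a * sin α - b * sin β) ^ 2 ≤ N ^ 2 := sq_le_sq' (abs_le.1 hy).1 (abs_le.1 hy).2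
  have hD : (a * cos α - b * cos β) ^ 2 + (a * sin α - b * sin β) ^ 2
      = (a - b) ^ 2 + 2 * (a * b) * (1 - cos (α - β)) := by
    rw [cos_sub]
    linear_combination a ^ 2 * sin_sq_add_cos_sq α + b ^ 2 * sin_sq_add_cos_sq β
  have hc1 : 0 ≤ 1 - cos (α - β) := by linarith [cos_le_one (α - β)]
  have hc2 : 1 - cos (α - β) ≤ 2 := by linarith [neg_one_le_cos (α - β)]
  have hab : 0 < a * b := mul_pos ha hb
  refine ⟨?_, ?_, ?_⟩
  · apply abs_le_of_sq_le_sq _ (by positivity)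
    nlinarith [mul_nonneg hab.le hc1]
  · have hq := cos_le_one_sub_mul_cos_sq h
    have hpi : 0 < π := pi_pos
    have h1 : 2 * (α - β) ^ 2 ≤ π ^ 2 * (1 - cos (α - β)) := by
      have : 2 / π ^ 2 * (α - β) ^ 2 ≤ 1 - cos (α - β) := by linarith
      calc 2 * (α - β) ^ 2 = π ^ 2 * (2 / π ^ 2 * (α - β) ^ 2) := by field_simp
        _ ≤ _ := by gcongr
    have h2 : b ^ 2 * (1 - cos (α - β)) ≤ 4 * N ^ 2 := by
      have : b ^ 2 * (1 - cos (α - β)) ≤ (2 * (a * b) + (a - b) ^ 2) * (1 - cos (α - β)) := by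
        gcongr
        nlinarith [sq_nonneg a]
      nlinarith [mul_le_mul_of_nonneg_left hc2 (sq_nonneg (a - b)), mul_nonneg hab.le hc1]
    have hp2 : π ^ 2 ≤ 16 := by nlinarith [pi_le_four]
    have h3 : (b * (α - β)) ^ 2 ≤ (8 * N) ^ 2 := by
      have e1 := mul_le_mul_of_nonneg_left h1 (sq_nonneg b)
      have e2 := mul_le_mul_of_nonneg_left h2 (sq_nonneg π)
      have e3 := mul_le_mul_of_nonneg_right hp2 (sq_nonneg N)
      nlinarith
    have := abs_le_of_sq_le_sq h3 (by positivity)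
    rwa [abs_mul, abs_of_pos hb] at this
  · have hcos : |cos α - cos β| ≤ |α - β| := abs_cos_sub_cos_le α β
    have hsin : |sin α - sin β| ≤ |α - β| := abs_sin_sub_sin_le α β
    rw [hN, Prod.norm_def]
    simp only [Theta, Prod.fst_sub, Prod.snd_sub, Real.norm_eq_abs]
    apply max_le
    · calc |a * cos α - b * cos β| = |(a - b) * cos α + b * (cos α - cos β)| := by ring_nf
        _ ≤ |(a - b) * cos α| + |b * (cos α - cos β)| := abs_add_le _ _
        _ = |a - b| * |cos α| + b * |cos α - cos β| := by rw [abs_mul, abs_mul, abs_of_pos hb]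
        _ ≤ |a - b| * 1 + b * |α - β| := by
          gcongr
          exact abs_cos_le_one α
        _ = _ := by ring
    · calc |a * sin α - b * sin β| = |(a - b) * sin α + b * (sin α - sin β)| := by ring_nf
        _ ≤ |(a - b) * sin α| + |b * (sin α - sin β)| := abs_add_le _ _
        _ = |a - b| * |sin α| + b * |sin α - sin β| := by rw [abs_mul, abs_mul, abs_of_pos hb]
        _ ≤ |a - b| * 1 + b * |α - β| := by
          gcongr
          exact abs_sin_le_one α
        _ = _ := by ring

lemma theta_inv (p : ℝ × ℝ) (hp : 0 < p.1) : Theta (ThetaInv p) = p := by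
  have e : Real.sqrt (p.1 ^ 2 + p.2 ^ 2) = p.1 * Real.sqrt (1 + (p.2 / p.1) ^ 2) := by
    rw [← Real.sqrt_sq hp.le, ← Real.sqrt_mul (sq_nonneg _), Real.sqrt_sq hp.le]
    congr 1
    field_simp
  have hs : Real.sqrt (1 + (p.2 / p.1) ^ 2) ≠ 0 := by positivity
  ext
  · simp only [Theta, ThetaInv]
    rw [cos_arctan, e]
    field_simp
  · simp only [Theta, ThetaInv]
    rw [sin_arctan, e]
    field_simp

lemma thetaInv_fst (p : ℝ × ℝ) (hp : 0 < p.1) :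
    0 < (ThetaInv p).1 ∧ (ThetaInv p).1 ≤ 2 * ‖p‖ := by
  constructor
  · simp only [ThetaInv]
    positivity
  · simp only [ThetaInv]
    apply Real.sqrt_le_iff.2 ⟨by positivity, ?_⟩
    have h1 := abs_le.1 (norm_fst_le p)
    have h2 := abs_le.1 (norm_snd_le p)
    nlinarith

theorem stmt_8 (H : ℝ × ℝ → ℝ)
    (hHdiff : ∀ p : ℝ × ℝ, 0 < p.1 → DifferentiableAt ℝ H p)
    (hHpos : ∀ p : ℝ × ℝ, 0 < p.1 → 0 < H p)
    (r₁ C₁ C₂ : ℝ) (hr₁ : 0 < r₁) (hC₁ : 0 < C₁) (hC₂ : 0 < C₂)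
    (hbound : ∀ p : ℝ × ℝ, p.1 ∈ Set.Ioc 0 r₁ → C₁ ≤ H p ∧ H p ≤ C₂)
    (C₃ : ℝ)
    (hderivbound : ∀ p : ℝ × ℝ, p.1 ∈ Set.Ioc 0 r₁ → ‖fderiv ℝ H p‖ ≤ C₃)
    (T : ℝ × ℝ → ℝ × ℝ) (hT : ∀ p : ℝ × ℝ, T p = (p.1 * H p, p.2))
    (S : ℝ × ℝ → ℝ × ℝ) (hS : ∀ p : ℝ × ℝ, S p = Theta (T (ThetaInv p))) :
    ∃ δ > 0, ∃ κ₁ > 0, ∃ κ₂ > 0,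
      ∀ u ∈ {p : ℝ × ℝ | 0 < ‖p‖ ∧ ‖p‖ < δ ∧ 0 < p.1},
        ∀ v ∈ {p : ℝ × ℝ | 0 < ‖p‖ ∧ ‖p‖ < δ ∧ 0 < p.1},
          κ₁ * ‖u - v‖ ≤ ‖S u - S v‖ ∧ ‖S u - S v‖ ≤ κ₂ * ‖u - v‖ := by
  have hC3 : 0 ≤ C₃ := (norm_nonneg _).trans (hderivbound (r₁, 0) ⟨hr₁, le_rfl⟩)
  have hconv : Convex ℝ {p : ℝ × ℝ | p.1 ∈ Set.Ioc 0 r₁} :=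
    (convex_Ioc 0 r₁).is_linear_preimage (IsLinearMap.mk (fun _ _ => rfl) (fun _ _ => rfl))
  refine ⟨min (r₁ / 2) (C₁ / (4 * (C₃ + 1))), by positivity, C₁ ^ 2 / (12 * C₁ + 16 * C₃),
    by positivity, 10 * C₂ + C₁ + 8 * C₃, by positivity, ?_⟩
  rintro u ⟨-, hu, hu1⟩ v ⟨-, hv, hv1⟩
  obtain ⟨ru0, ru⟩ := thetaInv_fst u hu1
  obtain ⟨rv0, rv⟩ := thetaInv_fst v hv1
  have hΔ : |(ThetaInv u).2 - (ThetaInv v).2| ≤ π := by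
    simp only [ThetaInv]
    have a1 := arctan_lt_pi_div_two (u.2 / u.1)
    have a2 := arctan_lt_pi_div_two (v.2 / v.1)
    have a3 := neg_pi_div_two_lt_arctan (u.2 / u.1)
    have a4 := neg_pi_div_two_lt_arctan (v.2 / v.1)
    rw [abs_le]
    constructor <;> linarith
  have hu' := lt_min_iff.1 hu
  have hv' := lt_min_iff.1 hv
  have hru : (ThetaInv u).1 ∈ Set.Ioc 0 r₁ := ⟨ru0, by linarith⟩
  have hrv : (ThetaInv v).1 ∈ Set.Ioc 0 r₁ := ⟨rv0, by linarith⟩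
  have hsmall : C₃ * (ThetaInv v).1 ≤ C₁ / 2 := by
    have h1 := hv'.2
    rw [lt_div_iff₀ (by positivity)] at h1
    have h2 := mul_le_mul_of_nonneg_left rv hC3
    nlinarith [norm_nonneg v]
  have hlip : |H (ThetaInv u) - H (ThetaInv v)| ≤
      C₃ * (|(ThetaInv u).1 - (ThetaInv v).1| + |(ThetaInv u).2 - (ThetaInv v).2|) := by
    have := hconv.norm_image_sub_le_of_norm_fderiv_le (𝕜 := ℝ) (f := H)
      (fun p hp => hHdiff p hp.1) (fun p hp => hderivbound p hp) hrv hru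
    refine this.trans ?_
    gcongr
    rw [Prod.norm_def]
    simp only [Prod.fst_sub, Prod.snd_sub, Real.norm_eq_abs]
    exact max_le (by linarith [abs_nonneg ((ThetaInv u).2 - (ThetaInv v).2)])
      (by linarith [abs_nonneg ((ThetaInv u).1 - (ThetaInv v).1)])
  have hHu := hbound _ hru
  have hHv := hbound _ hrv
  have P := polar_est _ _ _ _ ru0 rv0 hΔ
  have Q := polar_est _ _ _ _ (mul_pos ru0 (hHpos _ ru0)) (mul_pos rv0 (hHpos _ rv0)) hΔ
  simp only [Prod.mk.eta] at P
  rw [theta_inv u hu1, theta_inv v hv1] at P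
  rw [← hT, ← hT, ← hS, ← hS] at Q
  have hD0 := abs_nonneg ((ThetaInv u).2 - (ThetaInv v).2)
  generalize ‖S u - S v‖ = M at *
  generalize ‖u - v‖ = N at *
  generalize H (ThetaInv u) = hu at *
  generalize H (ThetaInv v) = hv at *
  generalize (ThetaInv u).1 = a at *
  generalize (ThetaInv v).1 = b at *
  generalize |(ThetaInv u).2 - (ThetaInv v).2| = D at *
  obtain ⟨P1, P2, P3⟩ := P
  obtain ⟨Q1, Q2, Q3⟩ := Q
  have hA0 := abs_nonneg (a - b)
  have hB0 : 0 ≤ b * D := mul_nonneg rv0.le hD0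
  have hw : b * |hu - hv| ≤ C₁ / 2 * |a - b| + C₃ * (b * D) := by
    have h1 := mul_le_mul_of_nonneg_left hlip rv0.le
    have h2 := mul_le_mul_of_nonneg_right hsmall hA0
    nlinarith
  have hup : |a * hu - b * hv| ≤ C₂ * |a - b| + b * |hu - hv| := by
    calc |a * hu - b * hv| = |hu * (a - b) + b * (hu - hv)| := by ring_nf
      _ ≤ |hu * (a - b)| + |b * (hu - hv)| := abs_add_le _ _
      _ = hu * |a - b| + b * |hu - hv| := by
        rw [abs_mul, abs_mul, abs_of_pos rv0, abs_of_pos (by linarith : 0 < hu)]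
      _ ≤ _ := by
        gcongr
        exact hHu.2
  have hlow : C₁ * |a - b| ≤ |a * hu - b * hv| + b * |hu - hv| := by
    calc C₁ * |a - b| ≤ hu * |a - b| := by
          gcongr
          exact hHu.1
      _ = |hu * (a - b)| := by rw [abs_mul, abs_of_pos (by linarith : 0 < hu)]
      _ = |(a * hu - b * hv) - b * (hu - hv)| := by ring_nf
      _ ≤ |a * hu - b * hv| + |b * (hu - hv)| := abs_sub _ _
      _ = _ := by rw [abs_mul b, abs_of_pos rv0]
  have hB1 : C₁ * (b * D) ≤ b * hv * D := by
    nlinarith [mul_le_mul_of_nonneg_right hHv.1 hB0]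
  have hB2 : b * hv * D ≤ C₂ * (b * D) := by
    nlinarith [mul_le_mul_of_nonneg_right hHv.2 hB0]
  constructor
  · rw [div_mul_eq_mul_div, div_le_iff₀ (by positivity)]
    have k1 : C₁ * |a - b| ≤ 4 * M + 2 * (C₃ * (b * D)) := by linarith
    have k2 : C₁ * (b * D) ≤ 8 * M := by linarith
    have k3 := mul_le_mul_of_nonneg_left k1 hC₁.le
    have k4 := mul_le_mul_of_nonneg_left k2 hC₁.le
    have k5 := mul_le_mul_of_nonneg_left k2 hC3
    have k6 := mul_le_mul_of_nonneg_left P3 (sq_nonneg C₁)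
    nlinarith
  · have k1 := mul_le_mul_of_nonneg_left P1 hC₂.le
    have k2 := mul_le_mul_of_nonneg_left P1 hC₁.le
    have k3 := mul_le_mul_of_nonneg_left P2 hC3
    have k4 := mul_le_mul_of_nonneg_left P2 hC₂.le
    nlinarith
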